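/- arXiv:1502.05813 — 2 statements merged into one kernel-verified Lean document; each statement's English description precedes it below -/
import Mathlib

section
/- Let n ≥ 3 and let λ be a multiplication on ℂⁿ. Then λ has level one if and only if λ is isomorphic to one of: pₙ (e₁eᵢ = eᵢ and eᵢe₁ = −eᵢ for 2 ≤ i ≤ n), n₃⊕𝔞ₙ₋₃ (e₁e₂ = e₃, e₂e₁ = −e₃), λ₂⊕𝔞ₙ₋₂ (e₁e₁ = e₂), or νₙ(α) (e₁e₁ = e₁, e₁eᵢ = αeᵢ and eᵢe₁ = (1−α)eᵢ for 2 ≤ i ≤ n) for some α ∈ ℂ. -/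
noncomputable section

abbrev V (n : ℕ) : Type := Fin n → ℂ

abbrev Bil (n : ℕ) : Type := V n →ₗ[ℂ] V n →ₗ[ℂ] V n

instance BilTop (n : ℕ) : TopologicalSpace (Bil n) :=
  TopologicalSpace.induced (fun μ : Bil n => fun x y : V n => μ x y) inferInstance

/-- The change-of-basis action of a linear automorphism on multiplications. -/
def act {n : ℕ} (g : V n ≃ₗ[ℂ] V n) (μ : Bil n) : Bil n :=
  LinearMap.mk₂ ℂ (fun x y => g (μ (g.symm x) (g.symm y)))
    (fun x x' y => by simp)
    (fun c x y => by simp)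
    (fun x y y' => by simp)
    (fun c x y => by simp)

/-- The orbit of a multiplication under the change-of-basis action. -/
def orb {n : ℕ} (μ : Bil n) : Set (Bil n) :=
  Set.range fun g : V n ≃ₗ[ℂ] V n => act g μ

/-- Two multiplications are isomorphic iff they lie in the same orbit. -/
def Isom {n : ℕ} (μ ν : Bil n) : Prop := ∃ g : V n ≃ₗ[ℂ] V n, act g μ = ν

def levelOne {n : ℕ} (lam : Bil n) : Prop :=
  lam ≠ 0 ∧ closure (orb lam) ⊆ orb lam ∪ {0}

def levelTwo {n : ℕ} (lam : Bil n) : Prop :=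
  (∀ μ ∈ closure (orb lam) \ orb lam, closure (orb μ) ⊆ orb μ ∪ {0}) ∧
  ∃ μ ∈ closure (orb lam) \ orb lam, μ ≠ 0

/-- `E n k` is the standard basis vector `e_{k+1}` of `ℂⁿ` (0-indexed `k`). -/
def E (n k : ℕ) : V n := fun m => if (m : ℕ) = k then 1 else 0

/-- The bilinear multiplication determined by a table of products of basis vectors. -/
def ofTable {n : ℕ} (c : Fin n → Fin n → V n) : Bil n :=
  LinearMap.mk₂ ℂ (fun x y => ∑ i : Fin n, ∑ j : Fin n, (x i * y j) • c i j)
    (fun x x' y => by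
      simp [add_mul, add_smul, Finset.sum_add_distrib])
    (fun a x y => by
      simp [Finset.smul_sum, smul_smul, mul_assoc])
    (fun x y y' => by
      simp [mul_add, add_smul, Finset.sum_add_distrib])
    (fun a x y => by
      simp [Finset.smul_sum, smul_smul, mul_assoc, mul_left_comm])

def JordanMul {n : ℕ} (lam : Bil n) : Prop :=
  (∀ x y : V n, lam x y = lam y x) ∧
  ∀ x y : V n, lam (lam x x) (lam y x) = lam (lam (lam x x) y) x

def LieMul {n : ℕ} (lam : Bil n) : Prop :=
  (∀ x : V n, lam x x = 0) ∧
  ∀ x y z : V n, lam x (lam y z) + lam y (lam z x) + lam z (lam x y) = 0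

def AssocMul {n : ℕ} (lam : Bil n) : Prop :=
  ∀ x y z : V n, lam (lam x y) z = lam x (lam y z)

/-- `pₙ`: `e₁eᵢ = eᵢ`, `eᵢe₁ = -eᵢ` for `2 ≤ i ≤ n`. -/
def pAlg (n : ℕ) : Bil n :=
  ofTable fun i j =>
    if i.val = 0 ∧ 1 ≤ j.val then E n j.val
    else if j.val = 0 ∧ 1 ≤ i.val then -E n i.val
    else 0

/-- `n₃ ⊕ 𝔞_{n-3}`: `e₁e₂ = e₃`, `e₂e₁ = -e₃`. -/
def n3a (n : ℕ) : Bil n :=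
  ofTable fun i j =>
    if i.val = 0 ∧ j.val = 1 then E n 2
    else if i.val = 1 ∧ j.val = 0 then -E n 2
    else 0

/-- `λ₂ ⊕ 𝔞_{n-2}`: `e₁e₁ = e₂`. -/
def lam2a (n : ℕ) : Bil n :=
  ofTable fun i j => if i.val = 0 ∧ j.val = 0 then E n 1 else 0

/-- `νₙ(α)`: `e₁e₁ = e₁`, `e₁eᵢ = α eᵢ`, `eᵢe₁ = (1-α) eᵢ` for `2 ≤ i ≤ n`. -/
def nu (n : ℕ) (α : ℂ) : Bil n :=
  ofTable fun i j =>
    if i.val = 0 ∧ j.val = 0 then E n 0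
    else if i.val = 0 ∧ 1 ≤ j.val then α • E n j.val
    else if j.val = 0 ∧ 1 ≤ i.val then (1 - α) • E n i.val
    else 0


open Filter Topology

theorem act_apply {n : ℕ} (g : V n ≃ₗ[ℂ] V n) (μ : Bil n) (x y : V n) :
    act g μ x y = g (μ (g.symm x) (g.symm y)) := rfl

theorem isom_symm {n : ℕ} {μ ν : Bil n} (h : Isom μ ν) : Isom ν μ := by
  obtain ⟨g, rfl⟩ := h
  refine ⟨g.symm, ?_⟩
  ext x y
  simp [act_apply]

theorem isom_trans {n : ℕ} {μ ν κ : Bil n} (h : Isom μ ν) (h' : Isom ν κ) : Isom μ κ := by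
  obtain ⟨g, rfl⟩ := h
  obtain ⟨g', rfl⟩ := h'
  refine ⟨g.trans g', ?_⟩
  ext x y
  simp [act_apply]

theorem levelOne_of {n : ℕ} {lam : Bil n} (h0 : lam ≠ 0) (C : Set (Bil n)) (hC : IsClosed C)
    (h1 : ∀ ν, Isom lam ν → ν ∈ C) (h2 : ∀ ν ∈ C, ν = 0 ∨ Isom lam ν) : levelOne lam := by
  refine ⟨h0, fun ν hν => ?_⟩
  have : closure (orb lam) ⊆ C := by
    apply closure_minimal _ hC
    rintro _ ⟨g, rfl⟩
    exact h1 _ ⟨g, rfl⟩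
  rcases h2 ν (this hν) with h | h
  · exact Or.inr h
  · exact Or.inl h

theorem cont_coe (n : ℕ) : Continuous (fun μ : Bil n => fun x y : V n => μ x y) :=
  continuous_induced_dom

theorem cont_eval {n : ℕ} (x y : V n) : Continuous (fun μ : Bil n => μ x y) :=
  (continuous_apply y).comp ((continuous_apply x).comp (cont_coe n))

theorem cont_eval' {n : ℕ} (x y : V n) (i : Fin n) : Continuous (fun μ : Bil n => μ x y i) :=
  (continuous_apply i).comp (cont_eval x y)

theorem vec_eq {n : ℕ} (w : V n) : w = ∑ i, w i • (Pi.single i 1 : V n) := by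
  ext j
  simp [Finset.sum_apply, Pi.single_apply]

theorem cont_eval2 {n : ℕ} (x y z : V n) : Continuous (fun μ : Bil n => μ (μ x y) z) := by
  have : (fun μ : Bil n => μ (μ x y) z) =
      fun μ : Bil n => ∑ i, (μ x y i) • μ (Pi.single i 1) z := by
    funext μ
    conv_lhs => rw [vec_eq (μ x y)]
    simp
  rw [this]
  exact continuous_finsetSum _ fun i _ => (cont_eval' x y i).smul (cont_eval _ z)

/-- Linear automorphisms act transitively on pairs (surjection, nonzero kernel vector). -/
theorem exists_equiv {n : ℕ} {W : Type} [AddCommGroup W] [Module ℂ W]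
    (F F0 : V n →ₗ[ℂ] W) (hF : Function.Surjective F) (hF0 : Function.Surjective F0)
    (v v0 : V n) (hv : F v = 0) (hv0 : F0 v0 = 0) (nv : v ≠ 0) (nv0 : v0 ≠ 0) :
    ∃ g : V n ≃ₗ[ℂ] V n, (∀ x, F0 (g x) = F x) ∧ g v = v0 := by
  obtain ⟨s, hs⟩ := F.exists_rightInverse_of_surjective (LinearMap.range_eq_top.2 hF)
  obtain ⟨s0, hs0⟩ := F0.exists_rightInverse_of_surjective (LinearMap.range_eq_top.2 hF0)
  replace hs : ∀ w, F (s w) = w := fun w => LinearMap.congr_fun hs w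
  replace hs0 : ∀ w, F0 (s0 w) = w := fun w => LinearMap.congr_fun hs0 w
  have e1 := LinearMap.finrank_range_add_finrank_ker F
  have e2 := LinearMap.finrank_range_add_finrank_ker F0
  rw [LinearMap.range_eq_top.2 hF] at e1
  rw [LinearMap.range_eq_top.2 hF0] at e2
  have e3 : Module.finrank ℂ (LinearMap.ker F) = Module.finrank ℂ (LinearMap.ker F0) := by omega
  let h1 := LinearEquiv.ofFinrankEq _ _ e3
  let vk : LinearMap.ker F := ⟨v, hv⟩
  let vk0 : LinearMap.ker F0 := ⟨v0, hv0⟩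
  have hvk : h1 vk ≠ 0 := by
    intro h
    rw [LinearEquiv.map_eq_zero_iff] at h
    exact nv (congrArg Subtype.val h)
  have hvk0 : vk0 ≠ 0 := fun h => nv0 (congrArg Subtype.val h)
  obtain ⟨h2, hh2⟩ := SeparatingDual.exists_continuousLinearEquiv_apply_eq (R := ℂ) hvk hvk0
  let Q : V n →ₗ[ℂ] LinearMap.ker F :=
    LinearMap.codRestrict (LinearMap.ker F) (LinearMap.id - s ∘ₗ F) (by
      intro x
      simp [hs])
  let h : LinearMap.ker F →ₗ[ℂ] LinearMap.ker F0 := h2.toLinearEquiv.toLinearMap ∘ₗ h1.toLinearMap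
  have hinj : Function.Injective h := by
    intro a b hab
    exact h1.injective (h2.injective hab)
  let g : V n →ₗ[ℂ] V n := s0 ∘ₗ F + (LinearMap.ker F0).subtype ∘ₗ h ∘ₗ Q
  have gF : ∀ x, F0 (g x) = F x := by
    intro x
    have : F0 ((h (Q x) : LinearMap.ker F0) : V n) = 0 := (h (Q x)).2
    simp [g, hs0, this]
  have gk : ∀ x (hx : F x = 0), g x = h ⟨x, hx⟩ := by
    intro x hx
    have : Q x = ⟨x, hx⟩ := by
      apply Subtype.ext
      simp [Q, hx]
    simp [g, hx, this]
  have ginj : Function.Injective g := by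
    rw [← LinearMap.ker_eq_bot, LinearMap.ker_eq_bot']
    intro x hx
    have hFx : F x = 0 := by rw [← gF, hx, map_zero]
    rw [gk x hFx] at hx
    have h3 : h ⟨x, hFx⟩ = 0 := Subtype.ext hx
    have h4 : (⟨x, hFx⟩ : LinearMap.ker F) = 0 := hinj (by rw [h3, map_zero])
    exact congrArg Subtype.val h4
  refine ⟨LinearEquiv.ofInjectiveEndo g ginj, fun x => ?_, ?_⟩
  · simpa using gF x
  · have : g v = v0 := by
      rw [gk v hv]
      exact congrArg Subtype.val hh2
    simpa using this

/-! Forms -/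

def FormA {n : ℕ} (α β : ℂ) (f : V n →ₗ[ℂ] ℂ) (μ : Bil n) : Prop :=
  ∀ x y, μ x y = (α * f x) • y + (β * f y) • x

def FormB {n : ℕ} {W : Type} [AddCommGroup W] [Module ℂ W] (B : W → W → ℂ)
    (F : V n →ₗ[ℂ] W) (v : V n) (μ : Bil n) : Prop :=
  ∀ x y, μ x y = B (F x) (F y) • v

theorem surj_of_ne {n : ℕ} {f : V n →ₗ[ℂ] ℂ} (hf : f ≠ 0) : Function.Surjective f :=
  LinearMap.surjective hf

theorem isomB {n : ℕ} {W : Type} [AddCommGroup W] [Module ℂ W] (B : W → W → ℂ)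
    (F F0 : V n →ₗ[ℂ] W) (hF : Function.Surjective F) (hF0 : Function.Surjective F0)
    (v v0 : V n) (hv : F v = 0) (hv0 : F0 v0 = 0) (nv : v ≠ 0) (nv0 : v0 ≠ 0)
    {μ μ0 : Bil n} (h : FormB B F v μ) (h0 : FormB B F0 v0 μ0) : Isom μ μ0 := by
  obtain ⟨g, hg, hgv⟩ := exists_equiv F F0 hF hF0 v v0 hv hv0 nv nv0
  refine ⟨g, LinearMap.ext fun x => LinearMap.ext fun y => ?_⟩
  rw [act_apply, h, h0, map_smul, hgv, ← hg, ← hg]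
  simp

theorem transB {n : ℕ} {W : Type} [AddCommGroup W] [Module ℂ W] (B : W → W → ℂ)
    (F : V n →ₗ[ℂ] W) (hF : Function.Surjective F)
    (v : V n) (hv : F v = 0) (nv : v ≠ 0)
    {μ μ0 : Bil n} (h : FormB B F v μ) (hi : Isom μ μ0) :
    ∃ (F0 : V n →ₗ[ℂ] W) (v0 : V n), Function.Surjective F0 ∧ F0 v0 = 0 ∧ v0 ≠ 0 ∧
      FormB B F0 v0 μ0 := by
  obtain ⟨g, rfl⟩ := hi
  refine ⟨F ∘ₗ g.symm.toLinearMap, g v, ?_, ?_, ?_, ?_⟩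
  · exact hF.comp g.symm.surjective
  · simp [hv]
  · simpa using nv
  · intro x y
    rw [act_apply, h, map_smul]
    rfl

theorem isomA {n : ℕ} (hn : 2 ≤ n) (α β : ℂ) (f f0 : V n →ₗ[ℂ] ℂ) (hf : f ≠ 0) (hf0 : f0 ≠ 0)
    {μ μ0 : Bil n} (h : FormA α β f μ) (h0 : FormA α β f0 μ0) : Isom μ μ0 := by
  have key : ∀ f : V n →ₗ[ℂ] ℂ, ∃ v, f v = 0 ∧ v ≠ 0 := by
    intro f
    have : LinearMap.ker f ≠ ⊥ := by
      apply LinearMap.ker_ne_bot_of_finrank_lt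
      simp
      omega
    obtain ⟨v, hv, hv'⟩ := Submodule.exists_mem_ne_zero_of_ne_bot this
    exact ⟨v, hv, hv'⟩
  obtain ⟨v, hv, nv⟩ := key f
  obtain ⟨v0, hv0, nv0⟩ := key f0
  obtain ⟨g, hg, -⟩ := exists_equiv f f0 (surj_of_ne hf) (surj_of_ne hf0) v v0 hv hv0 nv nv0
  refine ⟨g, LinearMap.ext fun x => LinearMap.ext fun y => ?_⟩
  rw [act_apply, h, h0, map_add, map_smul, map_smul, ← hg, ← hg]
  simp

theorem transA {n : ℕ} (α β : ℂ) (f : V n →ₗ[ℂ] ℂ)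
    {μ μ0 : Bil n} (h : FormA α β f μ) (hi : Isom μ μ0) :
    ∃ f0 : V n →ₗ[ℂ] ℂ, FormA α β f0 μ0 := by
  obtain ⟨g, rfl⟩ := hi
  refine ⟨f ∘ₗ g.symm.toLinearMap, ?_⟩
  intro x y
  rw [act_apply, h]
  simp

theorem closedA {n : ℕ} (α β : ℂ) :
    IsClosed {μ : Bil n | ∃ f : V n →ₗ[ℂ] ℂ, FormA α β f μ} := by
  let M : (V n →ₗ[ℂ] ℂ) →ₗ[ℂ] (V n → V n → V n) :=
    { toFun := fun f x y => (α * f x) • y + (β * f y) • x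
      map_add' := by
        intro f g
        funext x y
        simp only [LinearMap.add_apply, Pi.add_apply]
        module
      map_smul' := by
        intro c f
        funext x y
        simp only [LinearMap.smul_apply, Pi.smul_apply, RingHom.id_apply, smul_eq_mul]
        module }
  have hcl : IsClosed ((LinearMap.range M : Submodule ℂ (V n → V n → V n)) :
      Set (V n → V n → V n)) := Submodule.closed_of_finiteDimensional _
  have := hcl.preimage (cont_coe n)
  convert this using 1
  ext μ
  constructor
  · rintro ⟨f, hf⟩
    exact ⟨f, by funext x y; exact (hf x y).symm⟩
  · rintro ⟨f, hf⟩
    exact ⟨f, fun x y => (congrFun (congrFun hf x) y).symm⟩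

theorem levelOneA {n : ℕ} (hn : 2 ≤ n) (α β : ℂ) (f : V n →ₗ[ℂ] ℂ) {μ : Bil n} (hμ : μ ≠ 0)
    (h : FormA α β f μ) : levelOne μ := by
  have ne : ∀ (f : V n →ₗ[ℂ] ℂ) (ν : Bil n), FormA α β f ν → ν ≠ 0 → f ≠ 0 := by
    rintro f ν h hν rfl
    apply hν
    refine LinearMap.ext fun x => LinearMap.ext fun y => ?_
    rw [h]
    simp
  refine levelOne_of hμ _ (closedA α β) (fun ν hν => transA α β f h hν) ?_
  rintro ν ⟨f', hf'⟩
  by_cases hν : ν = 0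
  · exact Or.inl hν
  · exact Or.inr (isomA hn α β f f' (ne _ _ h hμ) (ne _ _ hf' hν) h hf')

def B1 : ℂ → ℂ → ℂ := fun a b => a * b

def B2 : ℂ × ℂ → ℂ × ℂ → ℂ := fun a b => a.1 * b.2 - a.2 * b.1

theorem formB_ne {n : ℕ} {W : Type} [AddCommGroup W] [Module ℂ W] {B : W → W → ℂ}
    (hB : ∃ a b, B a b ≠ 0)
    {F : V n →ₗ[ℂ] W} (hF : Function.Surjective F)
    {v : V n} (nv : v ≠ 0) {μ : Bil n} (h : FormB B F v μ) : μ ≠ 0 := by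
  rintro rfl
  obtain ⟨a, b, hab⟩ := hB
  obtain ⟨x, rfl⟩ := hF a
  obtain ⟨y, rfl⟩ := hF b
  have := h x y
  exact smul_ne_zero hab nv (this.symm.trans (by simp))

theorem levelOneB {n : ℕ} {W : Type} [AddCommGroup W] [Module ℂ W] (B : W → W → ℂ)
    (hB : ∃ a b, B a b ≠ 0)
    (F : V n →ₗ[ℂ] W) (hF : Function.Surjective F)
    (v : V n) (hv : F v = 0) (nv : v ≠ 0) {μ : Bil n} (h : FormB B F v μ)
    (C : Set (Bil n)) (hC : IsClosed C)
    (h1 : ∀ (F : V n →ₗ[ℂ] W) (v : V n) (ν : Bil n), F v = 0 → FormB B F v ν → ν ∈ C)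
    (h2 : ∀ ν ∈ C, ν ≠ 0 → ∃ (F : V n →ₗ[ℂ] W) (v : V n), Function.Surjective F ∧ F v = 0 ∧
      v ≠ 0 ∧ FormB B F v ν) : levelOne μ := by
  refine levelOne_of (formB_ne hB hF nv h) C hC ?_ ?_
  · intro ν hν
    obtain ⟨F0, v0, -, a, -, b⟩ := transB B F hF v hv nv h hν
    exact h1 _ _ _ a b
  · intro ν hν
    by_cases h0 : ν = 0
    · exact Or.inl h0
    · obtain ⟨F0, v0, a, b, c, d⟩ := h2 ν hν h0
      exact Or.inr (isomB B F F0 hF a v v0 hv b nv c h d)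

def C1 (n : ℕ) : Set (Bil n) :=
  {μ | (∀ x y, μ x y = μ y x) ∧ (∀ x y z, μ (μ x y) z = 0) ∧
    ∀ x y z w i j, μ x y i * μ z w j = μ x z j * μ y w i}

def C2 (n : ℕ) : Set (Bil n) :=
  {μ | (∀ x, μ x x = 0) ∧ (∀ x y z, μ (μ x y) z = 0) ∧
    (∀ x y z w i j, μ x y i * μ z w j = μ x y j * μ z w i) ∧
    ∀ x y z w i, μ x y i * μ z w i - μ x z i * μ y w i + μ x w i * μ y z i = 0}

theorem closedC1 (n : ℕ) : IsClosed (C1 n) := by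
  simp only [C1, Set.ofPred_and, Set.ofPred_forall]
  refine IsClosed.inter ?_ (IsClosed.inter ?_ ?_)
  · exact isClosed_iInter fun x => isClosed_iInter fun y =>
      isClosed_eq (cont_eval _ _) (cont_eval _ _)
  · exact isClosed_iInter fun x => isClosed_iInter fun y => isClosed_iInter fun z =>
      isClosed_eq (cont_eval2 _ _ _) continuous_const
  · exact isClosed_iInter fun x => isClosed_iInter fun y => isClosed_iInter fun z =>
      isClosed_iInter fun w => isClosed_iInter fun i => isClosed_iInter fun j =>
      isClosed_eq ((cont_eval' _ _ _).mul (cont_eval' _ _ _))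
        ((cont_eval' _ _ _).mul (cont_eval' _ _ _))

theorem closedC2 (n : ℕ) : IsClosed (C2 n) := by
  simp only [C2, Set.ofPred_and, Set.ofPred_forall]
  refine IsClosed.inter ?_ (IsClosed.inter ?_ (IsClosed.inter ?_ ?_))
  · exact isClosed_iInter fun x => isClosed_eq (cont_eval _ _) continuous_const
  · exact isClosed_iInter fun x => isClosed_iInter fun y => isClosed_iInter fun z =>
      isClosed_eq (cont_eval2 _ _ _) continuous_const
  · exact isClosed_iInter fun x => isClosed_iInter fun y => isClosed_iInter fun z =>
      isClosed_iInter fun w => isClosed_iInter fun i => isClosed_iInter fun j =>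
      isClosed_eq ((cont_eval' _ _ _).mul (cont_eval' _ _ _))
        ((cont_eval' _ _ _).mul (cont_eval' _ _ _))
  · exact isClosed_iInter fun x => isClosed_iInter fun y => isClosed_iInter fun z =>
      isClosed_iInter fun w => isClosed_iInter fun i =>
      isClosed_eq ((((cont_eval' _ _ _).mul (cont_eval' _ _ _)).sub
        ((cont_eval' _ _ _).mul (cont_eval' _ _ _))).add
          ((cont_eval' _ _ _).mul (cont_eval' _ _ _))) continuous_const

theorem levelOneB1 {n : ℕ} (f : V n →ₗ[ℂ] ℂ) (hf : Function.Surjective f)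
    (v : V n) (hv : f v = 0) (nv : v ≠ 0) {μ : Bil n} (h : FormB B1 f v μ) : levelOne μ := by
  refine levelOneB B1 ⟨1, 1, by simp [B1]⟩ f hf v hv nv h (C1 n) (closedC1 n) ?_ ?_
  · intro f v ν hv h
    refine ⟨fun x y => ?_, fun x y z => ?_, fun x y z w i j => ?_⟩
    · simp only [h x y, h y x, B1, mul_comm]
    · rw [h, h]
      simp [B1, hv]
    · simp only [h _ _, B1, Pi.smul_apply, smul_eq_mul]
      ring
  · rintro ν ⟨h1, h2, h3⟩ h0
    obtain ⟨u, hu⟩ : ∃ u, ν u u ≠ 0 := by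
      by_contra! hc
      apply h0
      refine LinearMap.ext fun x => LinearMap.ext fun y => ?_
      have := hc (x + y)
      simp only [map_add, LinearMap.add_apply, hc, h1 y x, zero_add, add_zero] at this
      simpa [← two_smul ℂ] using this
    obtain ⟨j, hj⟩ : ∃ j, ν u u j ≠ 0 := by
      by_contra! hc
      exact hu (funext hc)
    let f : V n →ₗ[ℂ] ℂ := (ν u u j)⁻¹ • (LinearMap.proj j ∘ₗ ν.flip u)
    have hfx : ∀ x, f x = (ν u u j)⁻¹ * ν x u j := fun x => by simp [f]
    have hfu : f u = 1 := by rw [hfx]; field_simp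
    refine ⟨f, ν u u, surj_of_ne (fun h => by simp [h] at hfu), ?_, hu, ?_⟩
    · rw [hfx, h2]; simp
    · intro x y
      ext i
      have e1 := h3 x y u u i j
      have e2 := h3 y u u u i j
      simp only [B1, Pi.smul_apply, smul_eq_mul, hfx]
      field_simp
      linear_combination (ν u u j) * e1 + ν x u j * e2

theorem surj2 {n : ℕ} (f g : V n →ₗ[ℂ] ℂ) (u w : V n) (h1 : f u = 1) (h2 : f w = 0)
    (h3 : g u = 0) (h4 : g w = 1) : Function.Surjective (f.prod g) := by
  rintro ⟨a, b⟩
  exact ⟨a • u + b • w, by simp [h1, h2, h3, h4]⟩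

theorem levelOneB2 {n : ℕ} (F : V n →ₗ[ℂ] ℂ × ℂ) (hF : Function.Surjective F)
    (v : V n) (hv : F v = 0) (nv : v ≠ 0) {μ : Bil n} (h : FormB B2 F v μ) : levelOne μ := by
  refine levelOneB B2 ⟨(1, 0), (0, 1), by simp [B2]⟩ F hF v hv nv h (C2 n) (closedC2 n) ?_ ?_
  · intro f v ν hv h
    refine ⟨fun x => ?_, fun x y z => ?_, fun x y z w i j => ?_, fun x y z w i => ?_⟩
    · simp [h x x, B2, mul_comm]
    · rw [h, h]
      simp [B2, hv]
    · simp only [h _ _, B2, Pi.smul_apply, smul_eq_mul]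
      ring
    · simp only [h _ _, B2, Pi.smul_apply, smul_eq_mul]
      ring
  · rintro ν ⟨h1, h2, h3, h4⟩ h0
    obtain ⟨u, w, hu⟩ : ∃ u w, ν u w ≠ 0 := by
      by_contra! hc
      apply h0
      refine LinearMap.ext fun x => LinearMap.ext fun y => hc x y
    obtain ⟨j, hj⟩ : ∃ j, ν u w j ≠ 0 := by
      by_contra! hc
      exact hu (funext hc)
    have anti : ∀ x y, ν x y = - ν y x := by
      intro x y
      have := h1 (x + y)
      simp only [map_add, LinearMap.add_apply, h1, zero_add, add_zero] at this
      exact eq_neg_of_add_eq_zero_right this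
    let f : V n →ₗ[ℂ] ℂ := (ν u w j)⁻¹ • (LinearMap.proj j ∘ₗ ν.flip w)
    let g : V n →ₗ[ℂ] ℂ := (ν u w j)⁻¹ • (LinearMap.proj j ∘ₗ ν u)
    have hfx : ∀ x, f x = (ν u w j)⁻¹ * ν x w j := fun x => by simp [f]
    have hgx : ∀ x, g x = (ν u w j)⁻¹ * ν u x j := fun x => by simp [g]
    refine ⟨f.prod g, ν u w, surj2 f g u w ?_ ?_ ?_ ?_, ?_, hu, ?_⟩
    · rw [hfx]; field_simp
    · rw [hfx, h1]; simp
    · rw [hgx, h1]; simp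
    · rw [hgx]; field_simp
    · ext
      · change f (ν u w) = 0
        rw [hfx, h2]; simp
      · change g (ν u w) = 0
        rw [hgx, anti u (ν u w), h2]; simp
    · intro x y
      ext i
      have e1 := h3 x y u w i j
      have e2 := h4 x y u w j
      have e3 : ν x u j = - ν u x j := by rw [anti x u]; rfl
      have e4 : ν y u j = - ν u y j := by rw [anti y u]; rfl
      rw [e3, e4] at e2
      change ν x y i = (f x * g y - g x * f y) * ν u w i
      simp only [hfx, hgx]
      field_simp
      linear_combination (ν u w j) * e1 + ν u w i * e2

/-! The models -/

theorem ext_basis {n : ℕ} {μ ν : Bil n}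
    (h : ∀ i j : Fin n, μ (Pi.single i 1) (Pi.single j 1) = ν (Pi.single i 1) (Pi.single j 1)) :
    μ = ν := by
  refine LinearMap.pi_ext' fun i => LinearMap.ext_ring ?_
  refine LinearMap.pi_ext' fun j => LinearMap.ext_ring ?_
  exact h i j

theorem ofTable_single {n : ℕ} (c : Fin n → Fin n → V n) (i j : Fin n) :
    ofTable c (Pi.single i 1) (Pi.single j 1) = c i j := by
  simp [ofTable, Pi.single_apply]

theorem E_eq {n : ℕ} (i : Fin n) : E n i.val = Pi.single i 1 := by
  ext m
  simp [E, Pi.single_apply, Fin.ext_iff]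

def mkA {n : ℕ} (a b : V n →ₗ[ℂ] ℂ) : Bil n :=
  LinearMap.mk₂ ℂ (fun x y => a x • y + b y • x)
    (fun x x' y => by simp only [map_add]; module)
    (fun c x y => by simp only [map_smul, smul_eq_mul]; module)
    (fun x y y' => by simp only [map_add]; module)
    (fun c x y => by simp only [map_smul, smul_eq_mul]; module)

theorem mkA_apply {n : ℕ} (a b : V n →ₗ[ℂ] ℂ) (x y : V n) :
    mkA a b x y = a x • y + b y • x := rfl

def mkB {n : ℕ} (B : V n →ₗ[ℂ] V n →ₗ[ℂ] ℂ) (v : V n) : Bil n :=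
  LinearMap.mk₂ ℂ (fun x y => B x y • v)
    (fun x x' y => by simp only [map_add, LinearMap.add_apply]; module)
    (fun c x y => by simp only [map_smul, smul_eq_mul, LinearMap.smul_apply]; module)
    (fun x y y' => by simp only [map_add]; module)
    (fun c x y => by simp only [map_smul, smul_eq_mul]; module)

theorem mkB_apply {n : ℕ} (B : V n →ₗ[ℂ] V n →ₗ[ℂ] ℂ) (v : V n) (x y : V n) :
    mkB B v x y = B x y • v := rfl

abbrev pr {n : ℕ} (i : Fin n) : V n →ₗ[ℂ] ℂ := LinearMap.proj i

theorem pAlg_form {n : ℕ} (z : Fin n) (hz : z.val = 0) : FormA 1 (-1) (pr z) (pAlg n) := by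
  have : pAlg n = mkA (pr z) (-pr z) := by
    refine ext_basis fun i j => ?_
    rw [pAlg, ofTable_single, mkA_apply, E_eq, E_eq]
    have hi : i.val = 0 ↔ z = i := by rw [Fin.ext_iff, hz, eq_comm]
    have hj : j.val = 0 ↔ z = j := by rw [Fin.ext_iff, hz, eq_comm]
    by_cases h1 : z = i <;> by_cases h2 : z = j <;>
      simp [hi, hj, h1, h2, Nat.one_le_iff_ne_zero, Pi.single_apply] <;> grind
  intro x y
  rw [this, mkA_apply]
  simp

theorem nu_form {n : ℕ} (z : Fin n) (hz : z.val = 0) (α : ℂ) :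
    FormA α (1 - α) (pr z) (nu n α) := by
  have : nu n α = mkA (α • pr z) ((1 - α) • pr z) := by
    refine ext_basis fun i j => ?_
    rw [nu, ofTable_single, mkA_apply, E_eq, E_eq, ← hz, E_eq, hz]
    have hi : i.val = 0 ↔ z = i := by rw [Fin.ext_iff, hz, eq_comm]
    have hj : j.val = 0 ↔ z = j := by rw [Fin.ext_iff, hz, eq_comm]
    by_cases h1 : z = i <;> by_cases h2 : z = j
    · subst h1; subst h2; simp [hz]
    all_goals
      simp [hi, hj, h1, h2, Nat.one_le_iff_ne_zero, Pi.single_apply] <;> grind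
  intro x y
  rw [this, mkA_apply]
  simp

theorem lam2a_form {n : ℕ} (z : Fin n) (hz : z.val = 0) :
    FormB B1 (pr z) (E n 1) (lam2a n) := by
  have : lam2a n = mkB (LinearMap.mk₂ ℂ (fun x y => x z * y z)
    (fun x x' y => by simp; ring)
    (fun c x y => by simp; ring)
    (fun x y y' => by simp; ring)
    (fun c x y => by simp; ring)) (E n 1) := by
    refine ext_basis fun i j => ?_
    rw [lam2a, ofTable_single, mkB_apply]
    have hi : i.val = 0 ↔ z = i := by rw [Fin.ext_iff, hz, eq_comm]
    have hj : j.val = 0 ↔ z = j := by rw [Fin.ext_iff, hz, eq_comm]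
    by_cases h1 : z = i <;> by_cases h2 : z = j <;>
      simp [hi, hj, h1, h2, Pi.single_apply]
  intro x y
  rw [this, mkB_apply]
  simp [B1]

theorem n3a_form {n : ℕ} (z o : Fin n) (hz : z.val = 0) (ho : o.val = 1) :
    FormB B2 ((pr z).prod (pr o)) (E n 2) (n3a n) := by
  have : n3a n = mkB (LinearMap.mk₂ ℂ (fun x y => x z * y o - x o * y z)
    (fun x x' y => by simp; ring)
    (fun c x y => by simp; ring)
    (fun x y y' => by simp; ring)
    (fun c x y => by simp; ring)) (E n 2) := by
    refine ext_basis fun i j => ?_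
    rw [n3a, ofTable_single, mkB_apply]
    have hi : i.val = 0 ↔ z = i := by rw [Fin.ext_iff, hz, eq_comm]
    have hj : j.val = 0 ↔ z = j := by rw [Fin.ext_iff, hz, eq_comm]
    have hi' : i.val = 1 ↔ o = i := by rw [Fin.ext_iff, ho, eq_comm]
    have hj' : j.val = 1 ↔ o = j := by rw [Fin.ext_iff, ho, eq_comm]
    have hzo : z ≠ o := by rw [Ne, Fin.ext_iff]; omega
    by_cases h1 : z = i <;> by_cases h2 : z = j <;> by_cases h3 : o = i <;> by_cases h4 : o = j <;>
      simp only [hi, hj, hi', hj', h1, h2, h3, h4, LinearMap.mk₂_apply, Pi.single_apply] <;>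
      first
        | (simp; done)
        | (exfalso; grind; done)
        | (have hij : i ≠ j := by grind
           simp [hij, hij.symm])
  intro x y
  rw [this, mkB_apply]
  simp [B2]

/-! Degenerations -/

theorem mem_closure_of_lim {n : ℕ} {lam μ : Bil n} (g : ℂ → (V n ≃ₗ[ℂ] V n))
    (R : ℂ → V n → V n → V n) (hR : ∀ x y, Continuous fun t => R t x y)
    (h0 : ∀ x y, R 0 x y = μ x y) (h1 : ∀ t ≠ 0, ∀ x y, act (g t) lam x y = R t x y) :
    μ ∈ closure (orb lam) := by
  refine mem_closure_of_tendsto (f := fun t => act (g t) lam) (b := 𝓝[≠] (0:ℂ)) ?_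
    (Eventually.of_forall fun t => ⟨g t, rfl⟩)
  rw [nhds_induced, tendsto_comap_iff, tendsto_pi_nhds]
  intro x
  rw [tendsto_pi_nhds]
  intro y
  have h2 : Tendsto (fun t => R t x y) (𝓝[≠] (0:ℂ)) (𝓝 (μ x y)) := by
    rw [← h0]
    exact ((hR x y).tendsto 0).mono_left nhdsWithin_le_nhds
  refine h2.congr' ?_
  filter_upwards [self_mem_nhdsWithin] with t ht
  exact (h1 t ht x y).symm

theorem projEquiv {n : ℕ} (P : V n →ₗ[ℂ] V n) (hP : ∀ x, P (P x) = P x) (a b : ℂ)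
    (ha : a ≠ 0) (hb : b ≠ 0) :
    ∃ g : V n ≃ₗ[ℂ] V n, (∀ x, g x = a⁻¹ • P x + b⁻¹ • (x - P x)) ∧
      ∀ x, g.symm x = a • P x + b • (x - P x) := by
  refine ⟨LinearEquiv.ofLinearMap (a⁻¹ • P + b⁻¹ • (LinearMap.id - P))
    (a • P + b • (LinearMap.id - P)) ?_ ?_, fun x => rfl, fun x => rfl⟩
  · refine LinearMap.ext fun x => ?_
    simp [hP, smul_smul, ha, hb]
  · refine LinearMap.ext fun x => ?_
    simp [hP, smul_smul, ha, hb]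

theorem degen1 {n : ℕ} (lam μ : Bil n) (P : V n →ₗ[ℂ] V n) (hP : ∀ x, P (P x) = P x)
    (hμ : ∀ x y, μ x y = lam (P x) (P y) - P (lam (P x) (P y))) : μ ∈ closure (orb lam) := by
  have : ∀ t : ℂ, ∃ g : V n ≃ₗ[ℂ] V n, t ≠ 0 → (∀ x, g x = t⁻¹ • P x + (t^2)⁻¹ • (x - P x)) ∧
      ∀ x, g.symm x = t • P x + (t^2) • (x - P x) := by
    intro t
    by_cases ht : t = 0
    · exact ⟨LinearEquiv.refl _ _, fun h => absurd ht h⟩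
    · obtain ⟨g, hg⟩ := projEquiv P hP t (t^2) ht (pow_ne_zero 2 ht)
      exact ⟨g, fun _ => hg⟩
  choose g hg using this
  refine mem_closure_of_lim g (fun t x y =>
    (lam (P x) (P y) - P (lam (P x) (P y)))
    + t • (P (lam (P x) (P y)) + (lam (P x) (y - P y) + lam (x - P x) (P y)) -
        P (lam (P x) (y - P y) + lam (x - P x) (P y)))
    + t^2 • (P (lam (P x) (y - P y) + lam (x - P x) (P y)) +
        lam (x - P x) (y - P y) - P (lam (x - P x) (y - P y)))
    + t^3 • P (lam (x - P x) (y - P y))) ?_ ?_ ?_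
  · intro x y
    fun_prop
  · intro x y
    simp [hμ]
  · intro t ht x y
    obtain ⟨h1, h2⟩ := hg t ht
    rw [act_apply, h1, h2, h2]
    generalize x - P x = x'
    generalize y - P y = y'
    simp only [map_add, map_smul, LinearMap.add_apply, LinearMap.smul_apply]
    match_scalars <;> field_simp <;> ring

theorem degenA {n : ℕ} (a b f : V n →ₗ[ℂ] ℂ) (u : V n) (hu : f u = 1) (lam μ : Bil n)
    (hl : ∀ x y, lam x y = a x • y + b y • x) (hμ : FormA (a u) (b u) f μ) :
    μ ∈ closure (orb lam) := by
  let P : V n →ₗ[ℂ] V n := f.smulRight u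
  have hPx : ∀ x, P x = f x • u := fun x => rfl
  have hP : ∀ x, P (P x) = P x := by
    intro x
    simp [hPx, hu]
  have : ∀ t : ℂ, ∃ g : V n ≃ₗ[ℂ] V n, t ≠ 0 → ∀ x, g.symm x = P x + t • (x - P x) := by
    intro t
    by_cases ht : t = 0
    · exact ⟨LinearEquiv.refl _ _, fun h => absurd ht h⟩
    · obtain ⟨g, -, hg⟩ := projEquiv P hP 1 t one_ne_zero ht
      exact ⟨g, fun _ x => by rw [hg, one_smul]⟩
  choose g hg using this
  refine mem_closure_of_lim g (fun t x y =>
    (a (P x) + t * a (x - P x)) • y + (b (P y) + t * b (y - P y)) • x) ?_ ?_ ?_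
  · intro x y
    fun_prop
  · intro x y
    simp [hμ x y, hPx, mul_comm]
  · intro t ht x y
    rw [act_apply, hl, map_add, map_smul, map_smul, LinearEquiv.apply_symm_apply,
      LinearEquiv.apply_symm_apply, hg t ht, hg t ht]
    simp

/-! Structure -/

theorem sep {n : ℕ} (S : Submodule ℂ (V n)) (z : V n) (hz : z ∉ S) :
    ∃ θ : V n →ₗ[ℂ] ℂ, θ z = 1 ∧ ∀ x ∈ S, θ x = 0 := by
  obtain ⟨θ, h1, h2⟩ := Submodule.exists_le_ker_of_notMem hz
  exact ⟨(θ z)⁻¹ • θ, by simp [h1], fun x hx => by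
    have : θ x = 0 := h2 hx
    simp [this]⟩

theorem caseA {n : ℕ} (hn : 3 ≤ n) (lam : Bil n) (x : V n) (φ : V n →ₗ[ℂ] ℂ) (hφ : φ x = 1)
    (hx : ∀ c : ℂ, lam x x ≠ c • x) : ∃ μ ∈ closure (orb lam),
      Isom μ (lam2a n) := by
  obtain ⟨θ, h1, h2⟩ := sep (Submodule.span ℂ {x}) (lam x x) (by
    rw [Submodule.mem_span_singleton]
    rintro ⟨c, hc⟩
    exact hx c hc.symm)
  have h3 : θ x = 0 := h2 x (Submodule.mem_span_singleton_self x)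
  let f : V n →ₗ[ℂ] ℂ := φ - φ (lam x x) • θ
  have f1 : f x = 1 := by simp [f, hφ, h3]
  have f2 : f (lam x x) = 0 := by simp [f, h1]
  have nv : lam x x ≠ 0 := by
    intro h
    exact hx 0 (by simp [h])
  let P : V n →ₗ[ℂ] V n := f.smulRight x
  have hPx : ∀ y, P y = f y • x := fun x => rfl
  let μ : Bil n := mkB (LinearMap.mk₂ ℂ (fun x y => f x * f y)
    (fun x x' y => by simp; ring)
    (fun c x y => by simp; ring)
    (fun x y y' => by simp; ring)
    (fun c x y => by simp; ring)) (lam x x)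
  have hμ : ∀ y z, μ y z = (f y * f z) • lam x x := fun y z => rfl
  refine ⟨μ, degen1 lam μ P ?_ ?_, ?_⟩
  · intro y; simp [hPx, f1]
  · intro y z
    simp [hPx, hμ, f2, smul_smul, mul_comm]
  · refine isomB B1 f (pr ⟨0, by omega⟩) (surj_of_ne fun h => by simp [h] at f1)
      (surj_of_ne fun h => ?_) (lam x x) (E n 1) f2 ?_ nv ?_ (fun y z => hμ y z)
      (lam2a_form _ rfl)
    · have := LinearMap.congr_fun h (Pi.single ⟨0, by omega⟩ 1)
      simp at this
    · simp [E]
    · intro h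
      have := congrFun h ⟨1, by omega⟩
      simp [E] at this

theorem caseB {n : ℕ} (hn : 3 ≤ n) (lam : Bil n) (x y : V n) (φ ψ : V n →ₗ[ℂ] ℂ)
    (hφ : φ x = 1) (hφ' : φ y = 0) (hψ : ψ x = 0) (hψ' : ψ y = 1)
    (c d p q : ℂ) (hxx : lam x x = c • x) (hyy : lam y y = d • y)
    (hyx : lam x y + lam y x = p • x + q • y)
    (hx : ∀ c d : ℂ, lam x y ≠ c • x + d • y) : ∃ μ ∈ closure (orb lam),
      Isom μ (n3a n) := by
  obtain ⟨θ, h1, h2⟩ := sep (Submodule.span ℂ {x, y}) (lam x y) (by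
    rw [Submodule.mem_span_pair]
    rintro ⟨c, d, hc⟩
    exact hx c d hc.symm)
  have h3 : θ x = 0 := h2 x (Submodule.subset_span (by simp))
  have h4 : θ y = 0 := h2 y (Submodule.subset_span (by simp))
  let f : V n →ₗ[ℂ] ℂ := φ - φ (lam x y) • θ
  let g : V n →ₗ[ℂ] ℂ := ψ - ψ (lam x y) • θ
  have f1 : f x = 1 := by simp [f, hφ, h3]
  have f2 : f y = 0 := by simp [f, hφ', h4]
  have f3 : f (lam x y) = 0 := by simp [f, h1]
  have g1 : g x = 0 := by simp [g, hψ, h3]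
  have g2 : g y = 1 := by simp [g, hψ', h4]
  have g3 : g (lam x y) = 0 := by simp [g, h1]
  have nv : lam x y ≠ 0 := by
    intro h
    exact hx 0 0 (by simp [h])
  let P : V n →ₗ[ℂ] V n := f.smulRight x + g.smulRight y
  have hPx : ∀ z, P z = f z • x + g z • y := fun x => rfl
  let μ : Bil n := mkB (LinearMap.mk₂ ℂ (fun x y => f x * g y - g x * f y)
    (fun x x' y => by simp; ring)
    (fun c x y => by simp; ring)
    (fun x y y' => by simp; ring)
    (fun c x y => by simp; ring)) (lam x y)
  have hμ : ∀ y' z, μ y' z = (f y' * g z - g y' * f z) • lam x y := fun y z => rfl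
  have hyx' : lam y x = p • x + q • y - lam x y := eq_sub_of_add_eq' hyx
  have Px : P x = x := by simp [hPx, f1, g1]
  have Py : P y = y := by simp [hPx, f2, g2]
  have Pv : P (lam x y) = 0 := by simp [hPx, f3, g3]
  refine ⟨μ, degen1 lam μ P ?_ ?_, ?_⟩
  · intro z
    rw [hPx z, map_add, map_smul, map_smul, Px, Py]
  · intro z w
    rw [hPx z, hPx w, hμ]
    simp only [map_add, map_smul, LinearMap.add_apply, LinearMap.smul_apply, hxx, hyy, hyx',
      map_sub, Px, Py, Pv]
    module
  · refine isomB B2 (f.prod g) ((pr ⟨0, by omega⟩).prod (pr ⟨1, by omega⟩))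
      (surj2 f g x y f1 f2 g1 g2)
      (surj2 _ _ (Pi.single ⟨0, by omega⟩ 1) (Pi.single ⟨1, by omega⟩ 1) ?_ ?_ ?_ ?_)
      (lam x y) (E n 2) ?_ ?_ nv ?_ (fun y z => hμ y z)
      (n3a_form _ _ rfl rfl)
    · simp
    · simp
    · simp
    · simp
    · simp [f3, g3]
    · simp [E]
    · intro h
      have := congrFun h ⟨2, by omega⟩
      simp [E] at this

theorem surjM {n : ℕ} (hn : 3 ≤ n) : Function.Surjective
    ((pr (⟨0, by omega⟩ : Fin n)).prod (pr (⟨1, by omega⟩ : Fin n))) :=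
  surj2 _ _ (Pi.single ⟨0, by omega⟩ 1) (Pi.single ⟨1, by omega⟩ 1) (by simp) (by simp)
    (by simp) (by simp)

theorem struct {n : ℕ} (hn : 3 ≤ n) (lam : Bil n)
    (hA : ¬ ∃ μ ∈ closure (orb lam), Isom μ (lam2a n))
    (hB : ¬ ∃ μ ∈ closure (orb lam), Isom μ (n3a n)) :
    ∃ a b : V n →ₗ[ℂ] ℂ, lam = mkA a b := by
  let e : Fin n → V n := fun i => Pi.single i 1
  have ee : ∀ i, e i i = 1 := fun i => by simp [e]
  have en : ∀ i j, i ≠ j → e i j = 0 := fun i j h => by simp [e, h]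
  have hA' : ∀ (x : V n) (i : Fin n), x i = 1 → ∃ c : ℂ, lam x x = c • x := by
    intro x i hi
    by_contra! hc
    exact hA (caseA hn lam x (pr i) hi hc)
  choose c hc using fun i => hA' (e i) i (ee i)
  have sym : ∀ i j, i ≠ j → lam (e i) (e j) + lam (e j) (e i) = c j • e i + c i • e j := by
    intro i j hij
    obtain ⟨p, hp⟩ := hA' (e i + e j) i (by simp [ee, en j i hij.symm])
    obtain ⟨q, hq⟩ := hA' (e i - e j) i (by simp [ee, en j i hij.symm])
    simp only [map_add, map_sub, LinearMap.add_apply, LinearMap.sub_apply, hc] at hp hq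
    have h1 := congrFun hp i
    have h2 := congrFun hp j
    have h3 := congrFun hq i
    have h4 := congrFun hq j
    simp only [Pi.add_apply, Pi.sub_apply, Pi.smul_apply, smul_eq_mul, ee, en i j hij,
      en j i hij.symm] at h1 h2 h3 h4
    have hpv : p = c i + c j := by linear_combination (-1/2 : ℂ) * (h1 + h2 + h3 + h4)
    rw [hpv] at hp
    have : lam (e i) (e j) + lam (e j) (e i) = (c i + c j) • (e i + e j) - c i • e i - c j • e j := by
      rw [← hp]; abel
    rw [this]
    module
  have spn : ∀ i j, i ≠ j → ∃ p q : ℂ, lam (e i) (e j) = p • e i + q • e j := by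
    intro i j hij
    by_contra! hcon
    exact hB (caseB hn lam (e i) (e j) (pr i) (pr j) (ee i) (en j i hij.symm) (en i j hij) (ee j)
      _ _ _ _ (hc i) (hc j) (sym i j hij) hcon)
  choose! p q hpq using spn
  have hpc : ∀ i j, i ≠ j → p i j + q j i = c j := by
    intro i j hij
    have := congrFun (sym i j hij) i
    simpa [hpq i j hij, hpq j i hij.symm, ee, en j i hij.symm] using this
  have hq : ∀ i j k, i ≠ j → i ≠ k → j ≠ k → q i j = q i k := by
    intro i j k hij hik hjk
    have spn2 : ∃ r s : ℂ, lam (e i) (e j + e k) = r • e i + s • (e j + e k) := by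
      obtain ⟨d, hd⟩ := hA' (e j + e k) j (by simp [ee, en k j hjk.symm])
      by_contra! hcon
      refine hB (caseB hn lam (e i) (e j + e k) (pr i) (pr j) (ee i) ?_ (en i j hij) ?_
        (c i) d (c j + c k) (c i) (hc i) hd ?_ hcon)
      · simp [en j i hij.symm, en k i hik.symm]
      · simp [ee, en k j hjk.symm]
      · have h1 := sym i j hij
        have h2 := sym i k hik
        simp only [map_add, LinearMap.add_apply]
        calc _ = (lam (e i) (e j) + lam (e j) (e i)) + (lam (e i) (e k) + lam (e k) (e i)) := by abel
          _ = _ := by rw [h1, h2]; module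
    obtain ⟨r, s, hrs⟩ := spn2
    rw [map_add, hpq i j hij, hpq i k hik] at hrs
    have h1 := congrFun hrs j
    have h2 := congrFun hrs k
    simp [ee, en i j hij, en i k hik, en j k hjk, en k j hjk.symm] at h1 h2
    rw [h1, h2]
  have : Nontrivial (Fin n) := Fin.nontrivial_iff_two_le.2 (by omega)
  choose σ hσ using fun i : Fin n => exists_ne i
  have hq' : ∀ i j, i ≠ j → q i j = q i (σ i) := by
    intro i j hij
    by_cases h : j = σ i
    · rw [← h]
    · exact hq i j (σ i) hij (hσ i).symm h
  let a : V n →ₗ[ℂ] ℂ := ∑ i, q i (σ i) • pr i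
  let b : V n →ₗ[ℂ] ℂ := ∑ i, (c i - q i (σ i)) • pr i
  have ha : ∀ i, a (Pi.single i 1) = q i (σ i) := by
    intro i
    simp [a, Pi.single_apply]
  have hb : ∀ i, b (Pi.single i 1) = c i - q i (σ i) := by
    intro i
    simp [b, Pi.single_apply]
  refine ⟨a, b, ext_basis fun i j => ?_⟩
  rw [mkA_apply, ha, hb]
  by_cases hij : i = j
  · subst hij
    have := hc i
    simp only [e] at this
    rw [this]
    module
  · have h1 := hpq i j hij
    have h2 := hpc i j hij
    rw [hq' j i (Ne.symm hij)] at h2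
    rw [hq' i j hij, eq_sub_of_add_eq h2] at h1
    simp only [e] at h1
    rw [h1, add_comm]

theorem pr_ne {n : ℕ} (i : Fin n) : (pr i : V n →ₗ[ℂ] ℂ) ≠ 0 := by
  intro h
  have := LinearMap.congr_fun h (Pi.single i 1)
  simp at this

theorem E_ne {n k : ℕ} (hk : k < n) : E n k ≠ 0 := by
  intro h
  have := congrFun h ⟨k, hk⟩
  simp [E] at this

theorem exists_degen {n : ℕ} (hn : 3 ≤ n) (lam : Bil n) (h0 : lam ≠ 0) :
    ∃ μ ∈ closure (orb lam), μ ≠ 0 ∧ (Isom μ (pAlg n) ∨ Isom μ (n3a n) ∨ Isom μ (lam2a n) ∨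
        ∃ α : ℂ, Isom μ (nu n α)) := by
  have nz : ∀ μ κ : Bil n, κ ≠ 0 → Isom μ κ → μ ≠ 0 := by
    rintro μ κ hκ ⟨g, rfl⟩ rfl
    apply hκ
    refine LinearMap.ext fun x => LinearMap.ext fun y => ?_
    simp [act_apply]
  by_cases hA : ∃ μ ∈ closure (orb lam), Isom μ (lam2a n)
  · obtain ⟨μ, h1, h2⟩ := hA
    refine ⟨μ, h1, nz _ _ ?_ h2, Or.inr (Or.inr (Or.inl h2))⟩
    exact formB_ne ⟨1, 1, by simp [B1]⟩ (surj_of_ne (pr_ne ⟨0, by omega⟩)) (E_ne (by omega))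
      (lam2a_form _ rfl)
  by_cases hB : ∃ μ ∈ closure (orb lam), Isom μ (n3a n)
  · obtain ⟨μ, h1, h2⟩ := hB
    refine ⟨μ, h1, nz _ _ ?_ h2, Or.inr (Or.inl h2)⟩
    exact formB_ne ⟨(1, 0), (0, 1), by simp [B2]⟩
      (surjM hn) (E_ne (by omega))
      (n3a_form ⟨0, by omega⟩ ⟨1, by omega⟩ rfl rfl)
  obtain ⟨a, b, hab⟩ := struct hn lam hA hB
  obtain ⟨u, hu⟩ : ∃ u, a u ≠ 0 ∨ b u ≠ 0 := by
    by_contra! hcon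
    apply h0
    refine LinearMap.ext fun x => LinearMap.ext fun y => ?_
    simp [hab, mkA_apply, hcon]
  have hu0 : u ≠ 0 := by
    rintro rfl
    simp at hu
  obtain ⟨f, hf, -⟩ := sep ⊥ u (by simpa using hu0)
  have fne : f ≠ 0 := by
    rintro rfl
    simp at hf
  let μ : Bil n := mkA (a u • f) (b u • f)
  have hμ : FormA (a u) (b u) f μ := fun x y => rfl
  have hcl : μ ∈ closure (orb lam) :=
    degenA a b f u hf lam μ (fun x y => by rw [hab, mkA_apply]) hμ
  by_cases hs : a u + b u = 0
  · have hbu : b u = - a u := by linear_combination hs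
    have hau : a u ≠ 0 := by
      intro h
      simp [hbu, h] at hu
    have hi : Isom μ (pAlg n) := by
      refine isomA (by omega) 1 (-1) (a u • f) (pr ⟨0, by omega⟩) (smul_ne_zero hau fne)
        (pr_ne _) (fun x y => ?_) (pAlg_form _ rfl)
      rw [hμ, hbu]
      simp
    refine ⟨μ, hcl, ?_, Or.inl hi⟩
    refine nz _ _ ?_ hi
    intro h
    have h1 := pAlg_form (n := n) ⟨0, by omega⟩ rfl (Pi.single ⟨0, by omega⟩ 1)
      (Pi.single ⟨1, by omega⟩ 1)
    rw [h] at h1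
    have h2 := congrFun h1 ⟨1, by omega⟩
    simp at h2
  · have hi : Isom μ (nu n (a u / (a u + b u))) := by
      refine isomA (by omega) _ _ ((a u + b u) • f) (pr ⟨0, by omega⟩) (smul_ne_zero hs fne)
        (pr_ne _) (fun x y => ?_) (nu_form _ rfl _)
      rw [hμ]
      simp only [LinearMap.smul_apply, smul_eq_mul]
      congr 2
      · field_simp
      · field_simp
        ring
    refine ⟨μ, hcl, ?_, Or.inr (Or.inr (Or.inr ⟨_, hi⟩))⟩
    intro h
    have h1 := hμ u u
    rw [h, hf, mul_one, mul_one, ← add_smul] at h1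
    exact smul_ne_zero hs hu0 (h1.symm.trans (by simp))

/-- classification of multiplications of level one, `n ≥ 3`. -/
theorem level_one_classification (n : ℕ) (hn : 3 ≤ n) (lam : Bil n) :
    levelOne lam ↔
      (Isom lam (pAlg n) ∨ Isom lam (n3a n) ∨ Isom lam (lam2a n) ∨
        ∃ α : ℂ, Isom lam (nu n α)) := by
  constructor
  · rintro ⟨h0, h1⟩
    obtain ⟨μ, hμ, hne, h⟩ := exists_degen hn lam h0
    rcases h1 hμ with h2 | h2
    · have hi : Isom lam μ := h2
      rcases h with h | h | h | ⟨α, h⟩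
      · exact Or.inl (isom_trans hi h)
      · exact Or.inr (Or.inl (isom_trans hi h))
      · exact Or.inr (Or.inr (Or.inl (isom_trans hi h)))
      · exact Or.inr (Or.inr (Or.inr ⟨α, isom_trans hi h⟩))
    · exact absurd h2 hne
  · have nz : ∀ κ : Bil n, κ ≠ 0 → Isom lam κ → lam ≠ 0 := by
      rintro κ hκ ⟨g, rfl⟩ rfl
      apply hκ
      refine LinearMap.ext fun x => LinearMap.ext fun y => ?_
      simp [act_apply]
    have z0 : E n 0 = Pi.single ⟨0, by omega⟩ 1 := E_eq ⟨0, by omega⟩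
    rintro (h | h | h | ⟨α, h⟩)
    · obtain ⟨f, hf⟩ := transA _ _ _ (pAlg_form ⟨0, by omega⟩ rfl) (isom_symm h)
      refine levelOneA (by omega) _ _ f (nz _ ?_ h) hf
      intro h
      have h1 := pAlg_form (n := n) ⟨0, by omega⟩ rfl (Pi.single ⟨0, by omega⟩ 1)
        (Pi.single ⟨1, by omega⟩ 1)
      rw [h] at h1
      have h2 := congrFun h1 ⟨1, by omega⟩
      simp at h2
    · obtain ⟨F, v, h1, h2, h3, h4⟩ := transB B2 _
        (surjM hn) _ (by simp [E]) (E_ne (by omega))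
        (n3a_form ⟨0, by omega⟩ ⟨1, by omega⟩ rfl rfl) (isom_symm h)
      exact levelOneB2 F h1 v h2 h3 h4
    · obtain ⟨F, v, h1, h2, h3, h4⟩ := transB B1 _ (surj_of_ne (pr_ne ⟨0, by omega⟩)) _
        (by simp [E]) (E_ne (by omega)) (lam2a_form ⟨0, by omega⟩ rfl) (isom_symm h)
      exact levelOneB1 F h1 v h2 h3 h4
    · obtain ⟨f, hf⟩ := transA _ _ _ (nu_form ⟨0, by omega⟩ rfl α) (isom_symm h)
      refine levelOneA (by omega) _ _ f (nz _ ?_ h) hf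
      intro h
      have h1 := nu_form (n := n) ⟨0, by omega⟩ rfl α (Pi.single ⟨0, by omega⟩ 1)
        (Pi.single ⟨0, by omega⟩ 1)
      rw [h] at h1
      have h2 := congrFun h1 ⟨0, by omega⟩
      simp at h2
end
end

section
/- Let n ≥ 5, let α ∈ ℂ with α ≠ 0 and α ≠ 1, and let λ be the Lie multiplication gₙ,₁(α) on ℂⁿ. Then Der(λ) has dimension n² − 3n + 4, there exists an abelian ideal of λ of dimension n − 1, and every abelian ideal of λ has dimension at most n − 1. -/
noncomputable section

/-- The space of derivations of a multiplication. -/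
def Der {n : ℕ} (lam : Bil n) : Submodule ℂ (Module.End ℂ (V n)) where
  carrier := { D | ∀ x y : V n, D (lam x y) = lam (D x) y + lam x (D y) }
  add_mem' := by
    intro a b ha hb x y
    simp only [LinearMap.add_apply, ha x y, hb x y, map_add, LinearMap.add_apply]
    abel
  zero_mem' := by intro x y; simp
  smul_mem' := by
    intro c a ha x y
    simp only [LinearMap.smul_apply, ha x y, map_smul, smul_add, LinearMap.smul_apply]

/-- `I` is an abelian ideal of the (Lie) multiplication `lam`. -/
def IsAbelianIdeal {n : ℕ} (lam : Bil n) (I : Submodule ℂ (V n)) : Prop :=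
  (∀ x : V n, ∀ v ∈ I, lam x v ∈ I) ∧ ∀ v ∈ I, ∀ w ∈ I, lam v w = 0
/-- `n₅,₁ ⊕ 𝔞_{n-5}`: `[e₁,e₃] = e₅`, `[e₂,e₄] = e₅`. -/
def n51 (n : ℕ) : Bil n :=
  ofTable fun i j =>
    if i.val = 0 ∧ j.val = 2 then E n 4
    else if i.val = 2 ∧ j.val = 0 then -E n 4
    else if i.val = 1 ∧ j.val = 3 then E n 4
    else if i.val = 3 ∧ j.val = 1 then -E n 4
    else 0

/-- `n₅,₂ ⊕ 𝔞_{n-5}`: `[e₁,e₂] = e₄`, `[e₁,e₃] = e₅`. -/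
def n52 (n : ℕ) : Bil n :=
  ofTable fun i j =>
    if i.val = 0 ∧ j.val = 1 then E n 3
    else if i.val = 1 ∧ j.val = 0 then -E n 3
    else if i.val = 0 ∧ j.val = 2 then E n 4
    else if i.val = 2 ∧ j.val = 0 then -E n 4
    else 0

/-- `r₂ ⊕ 𝔞_{n-2}`: `[e₁,e₂] = e₂`. -/
def r2 (n : ℕ) : Bil n :=
  ofTable fun i j =>
    if i.val = 0 ∧ j.val = 1 then E n 1
    else if i.val = 1 ∧ j.val = 0 then -E n 1
    else 0

/-- `g_{n,1}(α)`: `[e₁,e₂] = α e₂`, `[e₁,eᵢ] = eᵢ` for `3 ≤ i ≤ n`. -/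
def g1 (n : ℕ) (α : ℂ) : Bil n :=
  ofTable fun i j =>
    if i.val = 0 ∧ j.val = 1 then α • E n 1
    else if i.val = 1 ∧ j.val = 0 then -(α • E n 1)
    else if i.val = 0 ∧ 2 ≤ j.val then E n j.val
    else if j.val = 0 ∧ 2 ≤ i.val then -E n i.val
    else 0

/-- `g_{n,2}`: `[e₁,e₂] = e₂ + e₃`, `[e₁,eᵢ] = eᵢ` for `3 ≤ i ≤ n`. -/
def g2 (n : ℕ) : Bil n :=
  ofTable fun i j =>
    if i.val = 0 ∧ j.val = 1 then E n 1 + E n 2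
    else if i.val = 1 ∧ j.val = 0 then -(E n 1 + E n 2)
    else if i.val = 0 ∧ 2 ≤ j.val then E n j.val
    else if j.val = 0 ∧ 2 ≤ i.val then -E n i.val
    else 0


def dd (α : ℂ) {m : ℕ} (k : Fin (m+2)) : ℂ := if k.val = 0 then 0 else if k.val = 1 then α else 1

theorem dd_zero (α : ℂ) {m : ℕ} : dd α (0 : Fin (m+2)) = 0 := by simp [dd]

theorem dd_ne (α : ℂ) (h : α ≠ 0) {m : ℕ} (k : Fin (m+2)) : dd α k = 0 ↔ k = 0 := by
  unfold dd
  rw [Fin.ext_iff]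
  split_ifs <;> simp_all

theorem g1_apply (m : ℕ) (α : ℂ) (x y : V (m+2)) (k : Fin (m+2)) :
    g1 (m+2) α x y k = dd α k * (x 0 * y k - y 0 * x k) := by
  have key : ∀ i j : Fin (m+2),
      (if i.val = 0 ∧ j.val = 1 then α • E (m+2) 1
      else if i.val = 1 ∧ j.val = 0 then -(α • E (m+2) 1)
      else if i.val = 0 ∧ 2 ≤ j.val then E (m+2) j.val
      else if j.val = 0 ∧ 2 ≤ i.val then -E (m+2) i.val
      else 0 : V (m+2)) k = (if i = 0 then (if j = k then dd α k else 0) else 0)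
        - (if j = 0 then (if i = k then dd α k else 0) else 0) := by
    intro i j
    simp only [dd, Fin.ext_iff, Fin.val_zero]
    split_ifs <;> simp_all [E] <;> (have hz : ((0 : Fin (m+2)) : ℕ) = 0 := rfl) <;> omega
  simp only [g1, ofTable, LinearMap.mk₂_apply, Finset.sum_apply, Pi.smul_apply, key, smul_eq_mul,
    mul_sub, Finset.sum_sub_distrib]
  simp
  ring

def PP (α : ℂ) {m : ℕ} (p : Fin (m+2) × Fin (m+2)) : Prop :=
  dd α p.1 ≠ 0 ∧ (p.2 = 0 ∨ dd α p.1 = dd α p.2)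

theorem der_entry (m : ℕ) (α : ℂ) (h0 : α ≠ 0) (D : Module.End ℂ (V (m+2)))
    (hD : D ∈ Der (g1 (m+2) α)) (i j : Fin (m+2)) (h : ¬ PP α (i, j)) :
    D (Pi.single j 1) i = 0 := by
  have hb : ∀ j : Fin (m+2), j ≠ 0 → g1 (m+2) α (Pi.single 0 1) (Pi.single j 1)
      = dd α j • Pi.single j 1 := by
    intro j hj
    ext k
    rw [g1_apply]
    by_cases hk : k = j
    · subst hk; simp [hj]
    · by_cases hk0 : k = 0
      · subst hk0; simp [dd_zero, hk]
      · simp [hk, hk0]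
  have e : ∀ i j : Fin (m+2), j ≠ 0 → dd α j * D (Pi.single j 1) i =
      dd α i * (D (Pi.single 0 1) 0 * (Pi.single j 1 : V (m+2)) i) + 
      dd α i * (D (Pi.single j 1) i - D (Pi.single j 1) 0 * (Pi.single 0 1 : V (m+2)) i) := by
    intro i j hj
    have := congrFun (hD (Pi.single 0 1) (Pi.single j 1)) i
    rw [hb j hj, map_smul, Pi.add_apply, g1_apply, g1_apply] at this
    simpa [hj, hj.symm] using this
  have hr : ∀ j : Fin (m+2), D (Pi.single j 1) 0 = 0 := by
    intro j
    by_cases hj : j = 0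
    · subst hj
      have := e 1 1 (by simp)
      have h1 : dd α (1 : Fin (m+2)) ≠ 0 := by rw [Ne, dd_ne α h0]; simp
      simp at this
      tauto
    · have := e 0 j hj
      rw [dd_zero] at this
      have h1 : dd α j ≠ 0 := by rwa [Ne, dd_ne α h0]
      simp at this
      tauto
  by_cases hi : i = 0
  · rw [hi]; exact hr j
  · have hi' : dd α i ≠ 0 := by rwa [Ne, dd_ne α h0]
    have h2 : j ≠ 0 ∧ dd α i ≠ dd α j := by
      unfold PP at h
      tauto
    have := e i j h2.1
    rw [hr, hr] at this
    have h3 : (dd α i - dd α j) * D (Pi.single j 1) i = 0 := by linear_combination -this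
    exact (mul_eq_zero.mp h3).resolve_left (sub_ne_zero.mpr h2.2)

open Classical in
theorem mem_der (m : ℕ) (α : ℂ) (M : Matrix (Fin (m+2)) (Fin (m+2)) ℂ)
    (h : ∀ i j, ¬ PP α (i, j) → M i j = 0) : Matrix.toLin' M ∈ Der (g1 (m+2) α) := by
  intro x y
  have hr : ∀ z : V (m+2), (Matrix.toLin' M z) 0 = 0 := by
    intro z
    rw [Matrix.toLin'_apply, Matrix.mulVec, dotProduct]
    apply Finset.sum_eq_zero
    intro j _
    rw [h 0 j (by simp [PP, dd_zero]), zero_mul]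
  ext i
  rw [Pi.add_apply, g1_apply, g1_apply, hr, hr]
  simp only [Matrix.toLin'_apply, Matrix.mulVec, dotProduct, g1_apply]
  simp only [zero_mul, zero_sub, sub_zero, Finset.mul_sum, ← Finset.sum_neg_distrib,
    ← Finset.sum_add_distrib]
  apply Finset.sum_congr rfl
  intro j _
  by_cases hp : PP α (i, j)
  · rcases hp.2 with hj | hj
    · simp only at hj
      subst hj
      ring
    · simp only at hj
      rw [hj]; ring
  · rw [h i j hp]; ring

open Classical in
theorem der_finrank (m : ℕ) (α : ℂ) (h0 : α ≠ 0) :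
    Module.finrank ℂ (Der (g1 (m+2) α)) =
      Fintype.card {p : Fin (m+2) × Fin (m+2) // PP α p} := by
  let f : Der (g1 (m+2) α) →ₗ[ℂ] ({p : Fin (m+2) × Fin (m+2) // PP α p} → ℂ) :=
    { toFun := fun D p => D.1 (Pi.single p.1.2 1) p.1.1
      map_add' := by intros; rfl
      map_smul' := by intros; rfl }
  have hf : Function.Bijective f := by
    constructor
    · rw [injective_iff_map_eq_zero]
      intro D hD
      apply Subtype.ext
      apply LinearMap.pi_ext'
      intro j
      apply LinearMap.ext_ring
      ext i
      simp only [LinearMap.comp_apply, LinearMap.single_apply]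
      by_cases hp : PP α (i, j)
      · exact congrFun hD ⟨(i, j), hp⟩
      · exact der_entry m α h0 D.1 D.2 i j hp
    · intro g
      refine ⟨⟨Matrix.toLin' (Matrix.of fun i j =>
        if h : PP α (i, j) then g ⟨(i, j), h⟩ else 0), mem_der m α _ ?_⟩, ?_⟩
      · intro i j h
        simp [h]
      · ext ⟨⟨i, j⟩, hp⟩
        simp [f, hp]
  rw [(LinearEquiv.ofBijective f hf).finrank_eq, Module.finrank_fintype_fun_eq_card]

open Classical in
theorem card_PP (m : ℕ) (α : ℂ) (h0 : α ≠ 0) (h1 : α ≠ 1) :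
    Fintype.card {p : Fin (m+2) × Fin (m+2) // PP α p} = (m + 1) + 1 + m * m := by
  rw [Fintype.card_subtype, Finset.card_filter, Fintype.sum_prod_type]
  simp [Fin.sum_univ_succ, PP, dd, h0, h1, h1.symm, -Finset.sum_boole]
  ring

/-- derivations and maximal abelian ideal of g1. -/
theorem der_ab_g1 (n : ℕ) (hn : 5 ≤ n) (α : ℂ) (hα0 : α ≠ 0) (hα1 : α ≠ 1) :
    Module.finrank ℂ (Der (g1 n α)) = n ^ 2 - 3 * n + 4 ∧
    (∃ I : Submodule ℂ (V n), IsAbelianIdeal (g1 n α) I ∧ Module.finrank ℂ I = n - 1) ∧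
    (∀ I : Submodule ℂ (V n), IsAbelianIdeal (g1 n α) I → Module.finrank ℂ I ≤ n - 1) := by
  obtain ⟨m, rfl⟩ : ∃ m, n = m + 2 := ⟨n - 2, by omega⟩
  refine ⟨?_, ⟨LinearMap.ker (LinearMap.proj 0 : V (m+2) →ₗ[ℂ] ℂ), ⟨?_, ?_⟩, ?_⟩, ?_⟩
  · rw [der_finrank m α hα0, card_PP m α hα0 hα1]
    have : (m+2)^2 = (m * m + m - 2) + 3 * (m+2) := by
      zify [show 2 ≤ m * m + m by nlinarith]
      ring
    rw [this, Nat.add_sub_cancel]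
    have : 2 ≤ m * m + m := by nlinarith
    omega
  · intro x v _
    simp [g1_apply, dd_zero]
  · intro v hv w hw
    simp at hv hw
    ext k
    simp [g1_apply, hv, hw]
  · have := LinearMap.finrank_range_add_finrank_ker (LinearMap.proj 0 : V (m+2) →ₗ[ℂ] ℂ)
    rw [LinearMap.range_eq_top.mpr (LinearMap.proj_surjective 0), finrank_top,
      Module.finrank_self, Module.finrank_fin_fun] at this
    exact Nat.eq_sub_of_add_eq' this
  · intro I hI
    have hlt : Module.finrank ℂ I < Module.finrank ℂ (V (m+2)) := by
      apply Submodule.finrank_lt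
      rintro rfl
      have := congrFun (hI.2 (Pi.single 0 1) trivial (Pi.single 1 1) trivial) 1
      rw [g1_apply] at this
      simp [dd, hα0] at this
    rw [Module.finrank_fin_fun] at hlt
    omega
end
end
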